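/- Let τ ≥ 1 be a natural number, let L > 0, and let a, ζsq, σsq, η be nonnegative real numbers with η ≤ 1/(2Lτ). Suppose ψ_0, …, ψ_{τ−1} are nonnegative reals satisfying, for every s with 0 ≤ s ≤ τ−1, ψ_s ≤ η² s ∑_{h=0}^{s−1} (3a + 3ζsq + 3L² ψ_h) + η² s² σsq. Then ∑_{s=0}^{τ−1} ψ_s ≤ 2 η² τ³ (a + ζsq + σsq/3). -/

import Mathlib

theorem sum_range_cast_le_sq_div_two (n : ℕ) :
    ∑ s ∈ Finset.range n, (s : ℝ) ≤ (n : ℝ) ^ 2 / 2 := by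
  induction n with
  | zero => simp
  | succ k ih =>
    rw [Finset.sum_range_succ]
    push_cast
    linarith

theorem sum_range_cast_sq_le_cube_div_three (n : ℕ) :
    ∑ s ∈ Finset.range n, (s : ℝ) ^ 2 ≤ (n : ℝ) ^ 3 / 3 := by
  induction n with
  | zero => simp
  | succ k ih =>
    rw [Finset.sum_range_succ]
    push_cast
    have hk : (0 : ℝ) ≤ k := k.cast_nonneg
    linarith


/-- Closed drift recursion: if `η ≤ 1/(2Lτ)` and the nonnegative reals
`ψ 0, …, ψ (τ−1)` satisfy
`ψ s ≤ η² s ∑_{h<s} (3a + 3ζsq + 3L² ψ h) + η² s² σsq` for all `s < τ`,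
then `∑_{s<τ} ψ s ≤ 2 η² τ³ (a + ζsq + σsq/3)`. -/
theorem stmt_9 (τ : ℕ) (hτ : 1 ≤ τ) (L : ℝ) (hL : 0 < L)
    (a ζsq σsq η : ℝ) (ha : 0 ≤ a) (hζ : 0 ≤ ζsq) (hσ : 0 ≤ σsq)
    (hη0 : 0 ≤ η) (hη1 : η ≤ 1 / (2 * L * (τ : ℝ)))
    (ψ : ℕ → ℝ) (hψ : ∀ s ∈ Finset.range τ, 0 ≤ ψ s)
    (hrec : ∀ s ∈ Finset.range τ,
      ψ s ≤ η ^ 2 * (s : ℝ) * ∑ h ∈ Finset.range s, (3 * a + 3 * ζsq + 3 * L ^ 2 * ψ h)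
        + η ^ 2 * (s : ℝ) ^ 2 * σsq) :
    ∑ s ∈ Finset.range τ, ψ s
      ≤ 2 * η ^ 2 * (τ : ℝ) ^ 3 * (a + ζsq + σsq / 3) := by
  set S := ∑ s ∈ Finset.range τ, ψ s with hS
  have hS0 : 0 ≤ S := Finset.sum_nonneg hψ
  have hτ0 : (0 : ℝ) < τ := by exact_mod_cast hτ
  have hstep : (L * η * τ) ^ 2 ≤ 1 / 4 := by
    rw [le_div_iff₀ (by positivity)] at hη1
    have h0 : 0 ≤ L * η * τ := by positivity
    nlinarith
  have hbound : ∀ s ∈ Finset.range τ,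
      ψ s ≤ η ^ 2 * (3 * a + 3 * ζsq + σsq) * (s : ℝ) ^ 2 + 3 * L ^ 2 * η ^ 2 * S * s := by
    intro s hs
    have hpartial : ∑ h ∈ Finset.range s, ψ h ≤ S :=
      Finset.sum_le_sum_of_subset_of_nonneg
        (Finset.range_subset_range.2 (Finset.mem_range.1 hs).le) fun i hi _ => hψ i hi
    have hr := hrec s hs
    rw [Finset.sum_add_distrib, ← Finset.mul_sum, Finset.sum_const, Finset.card_range,
      nsmul_eq_mul] at hr
    have hm := mul_le_mul_of_nonneg_left hpartial
      (by positivity : 0 ≤ 3 * L ^ 2 * η ^ 2 * (s : ℝ))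
    linarith
  have hsum := Finset.sum_le_sum hbound
  rw [Finset.sum_add_distrib, ← Finset.mul_sum, ← Finset.mul_sum, ← hS] at hsum
  have hsq := mul_le_mul_of_nonneg_left (sum_range_cast_sq_le_cube_div_three τ)
    (by positivity : 0 ≤ η ^ 2 * (3 * a + 3 * ζsq + σsq))
  have hlin := mul_le_mul_of_nonneg_left (sum_range_cast_le_sq_div_two τ)
    (by positivity : 0 ≤ 3 * L ^ 2 * η ^ 2 * S)
  have habsorb := mul_le_mul_of_nonneg_right hstep hS0
  linarith
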